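/- Let G be a (d+1)-lateration graph and let p be a configuration of G in ℝ^d in general position. Then the framework G(p) is infinitesimally rigid. -/

import Mathlib

open scoped BigOperators RealInnerProductSpace

noncomputable section

/-- A configuration of a framework: an assignment of points in `ℝ^d` to vertices. -/
abbrev Config (V : Type*) (d : ℕ) := V → EuclideanSpace ℝ (Fin d)

/-- A configuration is in general position if every `d + 1` of its points are
affinely independent. -/
def InGeneralPosition {V : Type*} (d : ℕ) (p : Config V d) : Prop :=
  ∀ S : Finset V, S.card = d + 1 → AffineIndependent ℝ (fun i : S => p i.1)

/-- The space of infinitesimal flexes of the framework `G(p)`. -/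
def flexSpace {V : Type*} {d : ℕ} (G : SimpleGraph V) (p : Config V d) :
    Submodule ℝ (V → EuclideanSpace ℝ (Fin d)) where
  carrier := {q | ∀ i j, G.Adj i j → ⟪p i - p j, q i - q j⟫ = (0 : ℝ)}
  zero_mem' := by intro i j _; simp
  add_mem' := by
    intro a b ha hb i j hij
    have h : (a + b) i - (a + b) j = (a i - a j) + (b i - b j) := by
      simp only [Pi.add_apply]; abel
    rw [h, inner_add_right, ha i j hij, hb i j hij, add_zero]
  smul_mem' := by
    intro c a ha i j hij
    have h : (c • a) i - (c • a) j = c • (a i - a j) := by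
      simp only [Pi.smul_apply, smul_sub]
    rw [h, real_inner_smul_right, ha i j hij, mul_zero]

/-- A framework whose points affinely span `ℝ^d` is infinitesimally rigid if its space
of infinitesimal flexes has dimension exactly `d (d + 1) / 2`. -/
def InfinitesimallyRigid {V : Type*} {d : ℕ} (G : SimpleGraph V) (p : Config V d) :
    Prop :=
  affineSpan ℝ (Set.range p) = ⊤ ∧
    Module.finrank ℝ (flexSpace G p) = d * (d + 1) / 2

/-- `G` (on vertices `0, …, v - 1`, with `v ≥ d + 1`) is a `(d+1)`-lateration graph:
the first `d + 1` vertices induce a complete subgraph, and every later vertex `i` is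
adjacent to at least `d + 1` earlier vertices. -/
def IsLaterationGraph (d : ℕ) {v : ℕ} (G : SimpleGraph (Fin v))
    [DecidableRel G.Adj] : Prop :=
  d + 1 ≤ v ∧
    (∀ i j : Fin v, (i : ℕ) < d + 1 → (j : ℕ) < d + 1 → i ≠ j → G.Adj i j) ∧
    (∀ i : Fin v, d + 1 ≤ (i : ℕ) →
      d + 1 ≤ (Finset.univ.filter fun j : Fin v => (j : ℕ) < (i : ℕ) ∧ G.Adj i j).card)

/-- The skew matrix with prescribed strictly lower triangular entries. -/
def skewOf (d : ℕ) : ((Σ i : Fin d, Fin i) → ℝ) →ₗ[ℝ] Matrix (Fin d) (Fin d) ℝ where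
  toFun c := Matrix.of fun i j => if h : (j : ℕ) < i then c ⟨i, ⟨j, h⟩⟩ else
    if h : (i : ℕ) < j then - c ⟨j, ⟨i, h⟩⟩ else 0
  map_add' a b := by
    ext i j
    simp only [Matrix.of_apply, Matrix.add_apply, Pi.add_apply]
    split_ifs <;> ring
  map_smul' a b := by
    ext i j
    simp only [Matrix.of_apply, Matrix.smul_apply, Pi.smul_apply, smul_eq_mul, RingHom.id_apply]
    split_ifs <;> ring

lemma skewOf_apply (d : ℕ) (c) (i j : Fin d) : skewOf d c i j =
    if h : (j : ℕ) < i then c ⟨i, ⟨j, h⟩⟩ else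
      if h : (i : ℕ) < j then - c ⟨j, ⟨i, h⟩⟩ else 0 := rfl

lemma skewOf_inj (d : ℕ) : Function.Injective (skewOf d) := by
  intro a b h
  ext ⟨i, j⟩
  have hj : (j : ℕ) < d := j.2.trans i.2
  have := congrFun (congrFun h i) ⟨j, hj⟩
  simpa [skewOf_apply] using this

lemma skewOf_skew (d : ℕ) (c) : (skewOf d c).conjTranspose = - skewOf d c := by
  ext i j
  simp only [skewOf_apply, Matrix.conjTranspose_apply, star_trivial,
    Matrix.neg_apply]
  split_ifs <;> first | omega | simp

lemma exists_skewOf (d : ℕ) (N : Matrix (Fin d) (Fin d) ℝ) (hN : N.conjTranspose = - N) :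
    ∃ c, skewOf d c = N := by
  have h (i j) : N j i = - N i j := by
    simpa using congrFun (congrFun hN i) j
  refine ⟨fun s => N s.1 ⟨s.2, s.2.2.trans s.1.2⟩, ?_⟩
  ext i j
  simp only [skewOf_apply]
  split_ifs with h1 h2
  · rfl
  · simpa using (h j i).symm
  · obtain rfl : i = j := by ext; omega
    linarith [h i i]

lemma card_pairs (d : ℕ) : Fintype.card (Σ i : Fin d, Fin i) + d = d * (d + 1) / 2 := by
  rw [Fintype.card_sigma]
  simp only [Fintype.card_fin]
  rw [Fin.sum_univ_eq_sum_range (fun i => i) d, ← Finset.sum_range_succ,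
    Finset.sum_range_id, Nat.add_sub_cancel, mul_comm]

lemma skew_inner {d : ℕ} {L : EuclideanSpace ℝ (Fin d) →ₗ[ℝ] EuclideanSpace ℝ (Fin d)}
    (hL : LinearMap.adjoint L = -L) (x) : ⟪x, L x⟫ = (0 : ℝ) := by
  have h := LinearMap.adjoint_inner_left L x x
  rw [hL, LinearMap.neg_apply, inner_neg_left, real_inner_comm] at h
  linarith

/-- Trivial flexes. -/
def trivFlex {V : Type*} {d : ℕ} (p : Config V d) :
    (((Σ i : Fin d, Fin i) → ℝ) × EuclideanSpace ℝ (Fin d)) →ₗ[ℝ]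
      (V → EuclideanSpace ℝ (Fin d)) where
  toFun c := fun i => Matrix.toEuclideanLin (skewOf d c.1) (p i) + c.2
  map_add' a b := by
    funext i
    simp only [Prod.fst_add, Prod.snd_add, map_add, LinearMap.add_apply, Pi.add_apply]
    abel
  map_smul' a b := by
    funext i
    simp only [Prod.smul_fst, Prod.smul_snd, map_smul, LinearMap.smul_apply, Pi.smul_apply,
      smul_add, RingHom.id_apply]

lemma span_of_card {V : Type*} {d : ℕ} {p : Config V d} (hgen : InGeneralPosition d p)
    (S : Finset V) (hS : S.card = d + 1) :
    affineSpan ℝ (Set.range (fun i : S => p i.1)) = ⊤ := by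
  rw [(hgen S hS).affineSpan_eq_top_iff_card_eq_finrank_add_one]
  simp [hS]

/-- difference basis -/
lemma exists_basis {V : Type*} {d : ℕ} {p : Config V d} (hgen : InGeneralPosition d p)
    (S : Finset V) (hS : S.card = d + 1) (i0 : S) :
    ∃ b : Module.Basis {j : S // j ≠ i0} ℝ (EuclideanSpace ℝ (Fin d)),
      ∀ j, b j = p j.1.1 - p i0.1 := by
  let B : AffineBasis S ℝ (EuclideanSpace ℝ (Fin d)) :=
    ⟨fun i : S => p i.1, hgen S hS, span_of_card hgen S hS⟩
  exact ⟨B.basisOf i0, fun j => B.basisOf_apply i0 j⟩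

lemma orth_zero {V : Type*} {d : ℕ} {p : Config V d} (hgen : InGeneralPosition d p)
    (S : Finset V) (hS : S.card = d + 1) (x w : EuclideanSpace ℝ (Fin d))
    (h : ∀ j ∈ S, ⟪x - p j, w⟫ = (0 : ℝ)) : w = 0 := by
  obtain ⟨i0, hi0⟩ : S.Nonempty := by rw [← Finset.card_pos]; omega
  obtain ⟨b, hb⟩ := exists_basis hgen S hS ⟨i0, hi0⟩
  refine InnerProductSpace.ext_inner_left_basis b fun j => ?_
  have h1 := h i0 hi0
  have h2 := h j.1.1 j.1.2
  rw [hb, inner_zero_right]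
  simp only [inner_sub_left] at *
  linarith

lemma exists_affine {V : Type*} {d : ℕ} {p : Config V d} (hgen : InGeneralPosition d p)
    (S : Finset V) (hS : S.card = d + 1) (q : Config V d)
    (h : ∀ i ∈ S, ∀ j ∈ S, ⟪p i - p j, q i - q j⟫ = (0 : ℝ)) :
    ∃ (L : EuclideanSpace ℝ (Fin d) →ₗ[ℝ] EuclideanSpace ℝ (Fin d))
      (t : EuclideanSpace ℝ (Fin d)), LinearMap.adjoint L = -L ∧
      ∀ i ∈ S, q i = L (p i) + t := by
  obtain ⟨i0, hi0⟩ : S.Nonempty := by rw [← Finset.card_pos]; omega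
  obtain ⟨b, hb⟩ := exists_basis hgen S hS ⟨i0, hi0⟩
  let L := b.constr ℝ (fun j => q j.1.1 - q i0)
  have hL : ∀ j, L (b j) = q j.1.1 - q i0 := fun j => b.constr_basis ℝ _ j
  refine ⟨L, q i0 - L (p i0), ?_, ?_⟩
  · refine b.ext fun j => ?_
    refine InnerProductSpace.ext_inner_left_basis b fun i => ?_
    rw [LinearMap.adjoint_inner_right, LinearMap.neg_apply, inner_neg_right, hL, hL, hb, hb]
    have h1 := h i.1.1 i.1.2 i0 hi0
    have h2 := h j.1.1 j.1.2 i0 hi0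
    have h3 := h i.1.1 i.1.2 j.1.1 j.1.2
    rw [real_inner_comm]
    simp only [inner_sub_left, inner_sub_right] at *
    linarith
  · intro i hi
    by_cases hii : i = i0
    · subst hii; abel
    · have := hL ⟨⟨i, hi⟩, by simpa using hii⟩
      rw [hb, map_sub] at this
      simp only at this
      rw [add_sub, add_comm, add_sub_assoc, this]
      abel

lemma trivFlex_inj {V : Type*} {d : ℕ} {p : Config V d} (hgen : InGeneralPosition d p)
    (S : Finset V) (hS : S.card = d + 1) : Function.Injective (trivFlex p) := by
  rw [← LinearMap.ker_eq_bot, LinearMap.ker_eq_bot']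
  rintro ⟨c, t⟩ h
  have h' (i) : Matrix.toEuclideanLin (skewOf d c) (p i) + t = 0 := congrFun h i
  obtain ⟨i0, hi0⟩ : S.Nonempty := by rw [← Finset.card_pos]; omega
  obtain ⟨b, hb⟩ := exists_basis hgen S hS ⟨i0, hi0⟩
  have hL : Matrix.toEuclideanLin (skewOf d c) = 0 := by
    refine b.ext fun j => ?_
    rw [hb, map_sub, eq_neg_of_add_eq_zero_left (h' _), eq_neg_of_add_eq_zero_left (h' _)]
    simp
  have hc : c = 0 := by
    apply skewOf_inj
    rw [map_zero]
    exact (map_eq_zero_iff _ (Matrix.toEuclideanLin (𝕜 := ℝ)).injective).1 hL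
  have ht := h' i0
  rw [hL] at ht
  simp at ht
  simp [hc, ht]

lemma range_trivFlex {v d : ℕ} (G : SimpleGraph (Fin v)) [DecidableRel G.Adj]
    (hlat : IsLaterationGraph d G)
    (p : Config (Fin v) d) (hgen : InGeneralPosition d p)
    (S : Finset (Fin v)) (hS : S.card = d + 1) (hSm : ∀ i, i ∈ S ↔ (i : ℕ) < d + 1) :
    LinearMap.range (trivFlex p) = flexSpace G p := by
  obtain ⟨-, hK, hlater⟩ := hlat
  apply le_antisymm
  · rintro _ ⟨⟨c, t⟩, rfl⟩ i j -
    have : LinearMap.adjoint (Matrix.toEuclideanLin (skewOf d c))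
        = - Matrix.toEuclideanLin (skewOf d c) := by
      rw [← Matrix.toEuclideanLin_conjTranspose_eq_adjoint, skewOf_skew, map_neg]
    have := skew_inner this (p i - p j)
    rw [map_sub] at this
    simpa [trivFlex] using this
  · intro q hq
    obtain ⟨L, t, hL, hq0⟩ := exists_affine hgen S hS q (by
      intro i hi j hj
      by_cases hij : i = j
      · subst hij; simp
      · exact hq i j (hK i j ((hSm i).1 hi) ((hSm j).1 hj) hij))
    have key : ∀ n : ℕ, ∀ i : Fin v, (i : ℕ) = n → q i = L (p i) + t := by
      intro n
      induction n using Nat.strong_induction_on with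
      | _ n ih =>
        intro i hi
        by_cases hd : (i : ℕ) < d + 1
        · exact hq0 i ((hSm i).2 hd)
        · obtain ⟨T, hT, hTc⟩ := Finset.exists_subset_card_eq (hlater i (by omega))
          have : q i - (L (p i) + t) = 0 := by
            refine orth_zero hgen T hTc (p i) _ fun j hj => ?_
            have hj' := (Finset.mem_filter.1 (hT hj)).2
            have h1 := hq i j hj'.2
            have h2 := ih j (by omega) j rfl
            have h3 := skew_inner hL (p i - p j)
            have h4 : q i - (L (p i) + t) = (q i - q j) - L (p i - p j) := by
              rw [h2, map_sub]; abel
            rw [h4, inner_sub_right, h1, h3, sub_zero]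
          exact sub_eq_zero.1 this
    obtain ⟨N, rfl⟩ := (Matrix.toEuclideanLin (𝕜 := ℝ) (m := Fin d) (n := Fin d)).surjective L
    rw [← Matrix.toEuclideanLin_conjTranspose_eq_adjoint, ← map_neg] at hL
    obtain ⟨c, rfl⟩ := exists_skewOf d N ((Matrix.toEuclideanLin (𝕜 := ℝ)).injective hL)
    exact ⟨(c, t), funext fun i => (key i i rfl).symm⟩

/-- Any `(d+1)`-lateration framework in general position is infinitesimally rigid. -/
theorem laterationGraph_infinitesimallyRigid
    {v d : ℕ} (G : SimpleGraph (Fin v)) [DecidableRel G.Adj]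
    (hlat : IsLaterationGraph d G)
    (p : Config (Fin v) d) (hgen : InGeneralPosition d p) :
    InfinitesimallyRigid G p := by
  obtain ⟨S, hS, hSm⟩ : ∃ S : Finset (Fin v), S.card = d + 1 ∧ ∀ i, i ∈ S ↔ (i : ℕ) < d + 1 := by
    refine ⟨Finset.univ.map (Fin.castLEEmb hlat.1), by simp, fun i => ?_⟩
    simp only [Finset.mem_map, Finset.mem_univ, true_and]
    constructor
    · rintro ⟨a, rfl⟩
      exact a.2
    · intro h
      exact ⟨⟨i, h⟩, rfl⟩
  constructor
  · rw [eq_top_iff, ← span_of_card hgen S hS]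
    apply affineSpan_mono
    rintro _ ⟨i, rfl⟩
    exact ⟨i.1, rfl⟩
  · rw [← range_trivFlex G hlat p hgen S hS hSm,
      LinearMap.finrank_range_of_inj (trivFlex_inj hgen S hS), Module.finrank_prod,
      Module.finrank_fintype_fun_eq_card, finrank_euclideanSpace_fin, card_pairs]
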